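/- Let E be a saturated profile and assume E_r = [T_c(E)]_r for all r ∉ B := {1,…,r_*} ∪ {r_max+1,…,Γ}. Then there exists t̂ ∈ [0,1] such that, with Ê := (1−t̂)·E + t̂·S(E) and ΔE_r := E_r − E_{r−1}, one has F_c(S(E)) − F_c(E) = (1/2)·Σ_{r,r'=1}^Γ ΔE_r·ΔE_{r'}·[∂²F_c/∂E_r∂E_{r'}](Ê). -/

import Mathlib

open MeasureTheory ProbabilityTheory Filter Finset Real

noncomputable section

/-- Product of `B` i.i.d. standard Gaussians on `Fin B → ℝ` (law of `z`). -/
def stdGauss (B : ℕ) : Measure (Fin B → ℝ) :=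
  Measure.pi fun _ => gaussianReal 0 1

/-- The `j`-th standard basis vector of `ℝ^B` (a section). -/
def basisVec (B : ℕ) (j : Fin B) : Fin B → ℝ := fun k => if k = j then 1 else 0

/-- The MMSE denoiser `f_i(Σ)` of the effective Gaussian channel. -/
def denoiser (B : ℕ) (Sn : ℝ) (s z : Fin B → ℝ) (i : Fin B) : ℝ :=
  (1 + ∑ k ∈ Finset.univ.erase i,
      Real.exp ((s k - s i) * Real.logb 2 B / Sn ^ 2 +
        (z k - z i) * Real.sqrt (Real.logb 2 B) / Sn))⁻¹

/-- `E_{s,z}[ ∑_{i=1}^B (f_i(Σ) - s_i)^2 ]`, with `s` uniform over the basis vectors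
and `z` i.i.d. standard Gaussian: the MMSE of the effective `B`-dimensional channel. -/
def mmseB (B : ℕ) (Sn : ℝ) : ℝ :=
  (B : ℝ)⁻¹ * ∑ j : Fin B,
    ∫ z, (∑ i, (denoiser B Sn (basisVec B j) z i - basisVec B j i) ^ 2) ∂ stdGauss B

/-- Effective noise `Σ(E) = √(R(σ² + E))`. -/
def sigU (R σ2 E : ℝ) : ℝ := Real.sqrt (R * (σ2 + E))

/-- State evolution operator of the underlying system. -/
def Tu (B : ℕ) (R σ2 E : ℝ) : ℝ := mmseB B (sigU R σ2 E)

/-- Energy term of the underlying potential. -/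
def Uu (R σ2 E : ℝ) : ℝ :=
  (1 / (2 * R)) * Real.logb 2 ((σ2 + E) * Real.exp (-(E / (σ2 + E))))

/-- Entropy term of the underlying potential,
`S_u(Σ) = E_z[log_B(1 + ∑_{i=2}^B e_i(Σ))]`. -/
def Su (B : ℕ) (Sn : ℝ) : ℝ :=
  if h : 0 < B then
    letI : NeZero B := ⟨h.ne'⟩
    ∫ z, Real.logb B (1 + ∑ i ∈ Finset.univ.erase (0 : Fin B),
        Real.exp ((z i - z 0) * Real.sqrt (Real.logb 2 B) / Sn -
          Real.logb 2 B / Sn ^ 2)) ∂ stdGauss B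
  else 0

/-- Potential of the underlying system. -/
def Fu (B : ℕ) (R σ2 E : ℝ) : ℝ := Uu R σ2 E - Su B (sigU R σ2 E)

/-- The MSE floor `E₀ = lim_t T_u^{(t)}(0)`. -/
def mseFloor (B : ℕ) (R σ2 : ℝ) : ℝ :=
  limUnder atTop fun t : ℕ => (Tu B R σ2)^[t] 0

/-- Basin of attraction `𝒱₀` of the MSE floor. -/
def basin (B : ℕ) (R σ2 : ℝ) : Set ℝ :=
  {E | E ∈ Set.Icc (0:ℝ) 1 ∧
    Tendsto (fun t : ℕ => (Tu B R σ2)^[t] E) atTop (nhds (mseFloor B R σ2))}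

/-- Free energy gap `ΔF_u` (`+∞` if the complement of the basin is empty). -/
def gapFu (B : ℕ) (R σ2 : ℝ) : EReal :=
  ⨅ E ∈ Set.Icc (0:ℝ) 1 \ basin B R σ2,
    ((Fu B R σ2 E - Fu B R σ2 (mseFloor B R σ2) : ℝ) : EReal)

/-- Potential threshold `R_pot`. -/
def Rpot (B : ℕ) (σ2 : ℝ) : ℝ :=
  sSup {R : ℝ | 0 < R ∧ 0 < gapFu B R σ2}

/-- Effective noise `Σ_c(E)` of block `c` in the coupled system. -/
def sigC (R σ2 : ℝ) (Γ : ℕ) (J : Fin Γ → Fin Γ → ℝ) (E : Fin Γ → ℝ) (c : Fin Γ) : ℝ :=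
  (Real.sqrt ((Γ : ℝ)⁻¹ * ∑ r, J r c / (R * (σ2 + E r))))⁻¹

/-- Coupled state evolution operator `[T_c(E)]_r`. -/
def Tc (B : ℕ) (R σ2 : ℝ) (Γ : ℕ) (J : Fin Γ → Fin Γ → ℝ) (E : Fin Γ → ℝ) (r : Fin Γ) : ℝ :=
  (Γ : ℝ)⁻¹ * ∑ c, J r c * mmseB B (sigC R σ2 Γ J E c)

/-- Coupled potential `F_c`. -/
def Fc (B : ℕ) (R σ2 : ℝ) (Γ : ℕ) (J : Fin Γ → Fin Γ → ℝ) (E : Fin Γ → ℝ) : ℝ :=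
  (∑ r, Uu R σ2 (E r)) - ∑ c, Su B (sigC R σ2 Γ J E c)

/-- Shift operator: `[S(E)]_1 = E₀`, `[S(E)]_r = E_{r-1}` (0-based indexing). -/
def shiftProf (Γ : ℕ) (E0v : ℝ) (E : Fin Γ → ℝ) (r : Fin Γ) : ℝ :=
  if r.1 = 0 then E0v else E ⟨r.1 - 1, lt_of_le_of_lt (Nat.sub_le _ _) r.isLt⟩

/-- Partial derivative of a function of a profile with respect to coordinate `r`. -/
def pderiv (Γ : ℕ) (F : (Fin Γ → ℝ) → ℝ) (r : Fin Γ) (P : Fin Γ → ℝ) : ℝ :=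
  deriv (fun x => F (Function.update P r x)) (P r)

/-- Coupled SE operator with the pinning condition enforced on
`A = {1,…,3w} ∪ {Γ-3w+1,…,Γ}` (in 0-based indexing: `r < 3w` or `r ≥ Γ-3w`). -/
def TcPin (B : ℕ) (R σ2 : ℝ) (Γ w : ℕ) (J : Fin Γ → Fin Γ → ℝ) (E : Fin Γ → ℝ) (r : Fin Γ) : ℝ :=
  if r.1 < 3*w ∨ Γ - 3*w ≤ r.1 then 0 else Tc B R σ2 Γ J E r

/-- All-ones initial profile, pinned to `0` on the pinning set `A`. -/
def onesPin (Γ w : ℕ) : Fin Γ → ℝ :=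
  fun r => if r.1 < 3*w ∨ Γ - 3*w ≤ r.1 then 0 else 1

/-- Large section size (`B → ∞`) limit of the underlying potential. -/
def phiLim (R σ2 E : ℝ) : ℝ :=
  (1/(2*R)) * Real.logb 2 ((σ2 + E) * Real.exp (-(E/(σ2+E)))) -
    max 0 (1 - 1/(2 * Real.log 2 * R * (σ2 + E)))

/-- Stein's identity for the standard Gaussian law on `ℝ`. -/
theorem integral_id_mul_gaussianReal {f f' : ℝ → ℝ} {C C' : ℝ}
    (hf : ∀ t, HasDerivAt f (f' t) t) (hC : ∀ t, |f t| ≤ C) (hC' : ∀ t, |f' t| ≤ C') :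
    ∫ t, t * f t ∂gaussianReal 0 1 = ∫ t, f' t ∂gaussianReal 0 1 := by
  have hcont : Continuous f := continuous_iff_continuousAt.2 fun t => (hf t).continuousAt
  have hmeas' : Measurable f' := by
    rw [show f' = deriv f from funext fun t => (hf t).deriv.symm]
    exact measurable_deriv f
  have hpdf : ∀ t, HasDerivAt (gaussianPDFReal 0 1) (-t * gaussianPDFReal 0 1 t) t := by
    intro t
    have h : HasDerivAt (fun x : ℝ => (√(2 * π * 1))⁻¹ * rexp (-(x - 0) ^ 2 / (2 * 1)))
        (-t * ((√(2 * π * 1))⁻¹ * rexp (-(t - 0) ^ 2 / (2 * 1)))) t := by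
      have h1 : HasDerivAt (fun x : ℝ => -(x - 0) ^ 2 / (2 * 1)) (-t) t := by
        have := ((((hasDerivAt_id t).sub_const 0).pow 2).neg).div_const (2 * 1)
        convert! this using 1
        simp
        ring
      convert! (h1.exp).const_mul ((√(2 * π * 1))⁻¹) using 1
      ring
    simpa [gaussianPDFReal_def] using h
  have hid : Integrable (fun t : ℝ => t) (gaussianReal 0 1) :=
    (memLp_id_gaussianReal 1).integrable (by simp)
  have hint : ∀ {h : ℝ → ℝ}, Integrable h (gaussianReal 0 1) →
      Integrable (fun t => gaussianPDFReal 0 1 t * h t) := by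
    intro h hh
    rw [gaussianReal_of_var_ne_zero 0 one_ne_zero,
      integrable_withDensity_iff_integrable_smul' (measurable_gaussianPDF 0 1)
        (ae_of_all _ fun _ => gaussianPDF_lt_top)] at hh
    simpa [toReal_gaussianPDF] using hh
  have hif : Integrable f (gaussianReal 0 1) :=
    Integrable.of_bound hcont.aestronglyMeasurable C (ae_of_all _ hC)
  have hif' : Integrable f' (gaussianReal 0 1) :=
    Integrable.of_bound hmeas'.aestronglyMeasurable C' (ae_of_all _ hC')
  have hidf : Integrable (fun t => t * f t) (gaussianReal 0 1) :=
    hid.mul_bdd hcont.aestronglyMeasurable (ae_of_all _ hC)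
  have key := integral_mul_deriv_eq_deriv_mul_of_integrable (u := f) (u' := f')
    (v := gaussianPDFReal 0 1) (v' := fun t => -t * gaussianPDFReal 0 1 t)
    (fun t _ => hf t) (fun t _ => hpdf t)
    ((hint hidf).neg.congr (ae_of_all _ fun t => by simp; ring))
    ((hint hif').congr (ae_of_all _ fun t => by simp; ring))
    ((hint hif).congr (ae_of_all _ fun t => by simp; ring))
  rw [integral_gaussianReal_eq_integral_smul one_ne_zero,
    integral_gaussianReal_eq_integral_smul one_ne_zero]
  have e1 : ∫ t, gaussianPDFReal 0 1 t • (t * f t) =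
      -∫ t, f t * (-t * gaussianPDFReal 0 1 t) := by
    rw [← integral_neg]
    exact integral_congr_ae (ae_of_all _ fun t => by simp; ring)
  rw [e1, key, neg_neg]
  exact integral_congr_ae (ae_of_all _ fun t => by simp; ring)

instance isProbabilityMeasure_stdGauss (B : ℕ) : IsProbabilityMeasure (stdGauss B) := by
  unfold stdGauss; infer_instance

theorem integrable_eval_stdGauss (B : ℕ) (k : Fin B) :
    Integrable (fun z : Fin B → ℝ => z k) (stdGauss B) :=
  integrable_comp_eval (μ := fun _ => gaussianReal 0 1) (f := fun t : ℝ => t)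
    ((memLp_id_gaussianReal 1).integrable (by simp))

theorem integral_eval_stdGauss (B : ℕ) (k : Fin B) : ∫ z, z k ∂stdGauss B = 0 := by
  have h := integral_comp_eval (μ := fun _ : Fin B => gaussianReal 0 1) (i := k)
    (f := fun t : ℝ => t) (by fun_prop)
  rw [stdGauss, h, integral_id_gaussianReal]

/-- Stein's identity for the standard Gaussian law on `ℝ^B`. -/
theorem integral_eval_mul_stdGauss {B : ℕ} (k : Fin B) {f f' : (Fin B → ℝ) → ℝ} {C C' : ℝ}
    (hfm : Measurable f) (hfm' : Measurable f')
    (hf : ∀ z, HasDerivAt (fun t => f (Function.update z k t)) (f' z) (z k))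
    (hC : ∀ z, |f z| ≤ C) (hC' : ∀ z, |f' z| ≤ C') :
    ∫ z, z k * f z ∂stdGauss B = ∫ z, f' z ∂stdGauss B := by
  obtain _ | n := B
  · exact k.elim0
  have hmp := (measurePreserving_piFinSuccAbove (fun _ : Fin (n + 1) => gaussianReal 0 1) k).symm
  have hif : Integrable (fun z => z k * f z) (stdGauss (n + 1)) :=
    (integrable_eval_stdGauss _ k).mul_bdd hfm.aestronglyMeasurable (ae_of_all _ hC)
  have hif' : Integrable f' (stdGauss (n + 1)) :=
    Integrable.of_bound hfm'.aestronglyMeasurable C' (ae_of_all _ hC')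
  have hif2 := (hmp.integrable_comp_emb (MeasurableEquiv.measurableEmbedding _)).2 hif
  have hif2' := (hmp.integrable_comp_emb (MeasurableEquiv.measurableEmbedding _)).2 hif'
  have h1 := hmp.integral_comp' (fun z => z k * f z)
  have h2 := hmp.integral_comp' f'
  rw [stdGauss, ← h1, ← h2]
  refine (integral_prod_symm _ hif2).trans (Eq.trans ?_ (integral_prod_symm _ hif2').symm)
  refine integral_congr_ae (ae_of_all _ fun z => ?_)
  have h3 := integral_id_mul_gaussianReal (f := fun t => f (k.insertNth t z))
    (f' := fun t => f' (k.insertNth t z)) (C := C) (C' := C') (fun t => ?_)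
    (fun t => hC _) (fun t => hC' _)
  · simpa [MeasurableEquiv.piFinSuccAbove, Fin.insertNthEquiv] using h3
  · simpa using hf (k.insertNth t z)

/-- The law of `z` is invariant under permutations of the coordinates. -/
theorem integral_comp_perm_stdGauss {B : ℕ} (e : Equiv.Perm (Fin B)) (f : (Fin B → ℝ) → ℝ) :
    ∫ z, f (z ∘ e) ∂stdGauss B = ∫ z, f z ∂stdGauss B := by
  have hmp := measurePreserving_piCongrLeft (fun _ : Fin B => gaussianReal 0 1) e.symm
  have h := hmp.integral_comp' f
  rw [stdGauss, ← h]
  refine integral_congr_ae (ae_of_all _ fun z => ?_)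
  dsimp only
  congr 1
  ext i
  have := Equiv.piCongrLeft_apply_apply (fun _ : Fin B => ℝ) e.symm z (e i)
  simpa [MeasurableEquiv.coe_piCongrLeft] using this.symm

section Softmax

variable {ι : Type*} [Fintype ι]

/-- The softmax weights `exp (u i) / ∑ k, exp (u k)`. -/
def softmax (u : ι → ℝ) (i : ι) : ℝ := rexp (u i) / ∑ k, rexp (u k)

theorem sum_exp_pos [Nonempty ι] (u : ι → ℝ) : 0 < ∑ k, rexp (u k) :=
  Finset.sum_pos (fun _ _ => exp_pos _) univ_nonempty

theorem softmax_nonneg (u : ι → ℝ) (i : ι) : 0 ≤ softmax u i :=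
  div_nonneg (exp_pos _).le (Finset.sum_nonneg fun _ _ => (exp_pos _).le)

theorem sum_softmax [Nonempty ι] (u : ι → ℝ) : ∑ i, softmax u i = 1 := by
  simp only [softmax, ← Finset.sum_div]
  exact div_self (sum_exp_pos u).ne'

theorem softmax_le_one [Nonempty ι] (u : ι → ℝ) (i : ι) : softmax u i ≤ 1 := by
  rw [← sum_softmax u]
  exact Finset.single_le_sum (f := softmax u) (fun k _ => softmax_nonneg u k) (mem_univ i)

theorem abs_softmax_le_one [Nonempty ι] (u : ι → ℝ) (i : ι) : |softmax u i| ≤ 1 := by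
  rw [abs_of_nonneg (softmax_nonneg u i)]
  exact softmax_le_one u i

theorem softmax_eq_inv [DecidableEq ι] (u : ι → ℝ) (i : ι) :
    softmax u i = (1 + ∑ k ∈ univ.erase i, rexp (u k - u i))⁻¹ := by
  have h : 1 + ∑ k ∈ univ.erase i, rexp (u k - u i) = ∑ k, rexp (u k - u i) := by
    rw [← Finset.add_sum_erase univ _ (mem_univ i), sub_self, Real.exp_zero]
  rw [h, softmax]
  simp only [Real.exp_sub, ← Finset.sum_div, inv_div]

theorem hasDerivAt_sum_exp {u : ℝ → ι → ℝ} {u' : ι → ℝ} {t : ℝ}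
    (hu : ∀ k, HasDerivAt (fun s => u s k) (u' k) t) :
    HasDerivAt (fun s => ∑ k, rexp (u s k)) (∑ k, rexp (u t k) * u' k) t :=
  HasDerivAt.fun_sum fun k _ => (hu k).exp

theorem hasDerivAt_log_sum_exp [Nonempty ι] {u : ℝ → ι → ℝ} {u' : ι → ℝ} {t : ℝ}
    (hu : ∀ k, HasDerivAt (fun s => u s k) (u' k) t) :
    HasDerivAt (fun s => Real.log (∑ k, rexp (u s k))) (∑ k, softmax (u t) k * u' k) t := by
  convert! (hasDerivAt_sum_exp hu).log (sum_exp_pos (u t)).ne' using 1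
  rw [Finset.sum_div]
  exact Finset.sum_congr rfl fun k _ => by rw [softmax]; ring

theorem hasDerivAt_softmax [Nonempty ι] {u : ℝ → ι → ℝ} {u' : ι → ℝ} {t : ℝ}
    (hu : ∀ k, HasDerivAt (fun s => u s k) (u' k) t) (i : ι) :
    HasDerivAt (fun s => softmax (u s) i)
      (softmax (u t) i * (u' i - ∑ k, softmax (u t) k * u' k)) t := by
  have hZ := (sum_exp_pos (u t)).ne'
  convert! (hu i).exp.div (hasDerivAt_sum_exp hu) hZ using 1
  have h : ∑ k, softmax (u t) k * u' k =
      (∑ k, rexp (u t k) * u' k) / ∑ k, rexp (u t k) := by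
    rw [Finset.sum_div]
    exact Finset.sum_congr rfl fun k _ => by rw [softmax]; ring
  rw [h, softmax]
  field_simp

theorem abs_sum_softmax_mul_le [Nonempty ι] (u v : ι → ℝ) {b : ℝ} (hb : ∀ k, |v k| ≤ b) :
    |∑ k, softmax u k * v k| ≤ b := by
  refine (Finset.abs_sum_le_sum_abs _ _).trans ?_
  calc ∑ k, |softmax u k * v k| ≤ ∑ k, softmax u k * b := by
        refine Finset.sum_le_sum fun k _ => ?_
        rw [abs_mul, abs_of_nonneg (softmax_nonneg u k)]
        exact mul_le_mul_of_nonneg_left (hb k) (softmax_nonneg u k)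
    _ = b := by rw [← Finset.sum_mul, sum_softmax, one_mul]

theorem abs_log_sum_exp_le [Nonempty ι] (u : ι → ℝ) {b : ℝ} (hb : ∀ k, |u k| ≤ b) :
    |Real.log (∑ k, rexp (u k))| ≤ Real.log (Fintype.card ι) + b := by
  have hcard : (1 : ℝ) ≤ Fintype.card ι := by exact_mod_cast Fintype.card_pos (α := ι)
  have hlog := Real.log_nonneg hcard
  obtain ⟨i⟩ := ‹Nonempty ι›
  rw [abs_le]
  constructor
  · have h1 : u i ≤ Real.log (∑ k, rexp (u k)) := by
      rw [Real.le_log_iff_exp_le (sum_exp_pos u)]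
      exact Finset.single_le_sum (f := fun k => rexp (u k)) (fun _ _ => (exp_pos _).le)
        (mem_univ i)
    linarith [neg_abs_le (u i), hb i]
  · rw [Real.log_le_iff_le_exp (sum_exp_pos u), Real.exp_add, Real.exp_log (by linarith)]
    calc ∑ k, rexp (u k) ≤ ∑ _k : ι, rexp b :=
          Finset.sum_le_sum fun k _ => exp_le_exp.2 ((le_abs_self _).trans (hb k))
      _ = Fintype.card ι * rexp b := by simp

end Softmax

/-- Exponents of the posterior weights when section `j` is sent at signal amplitude `y`. -/
def gibbsEnergy (B : ℕ) (j : Fin B) (y : ℝ) (z : Fin B → ℝ) (k : Fin B) : ℝ :=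
  y * z k + y ^ 2 * basisVec B j k

/-- The derivative of `gibbsEnergy` in the signal amplitude. -/
def gibbsEnergyDeriv (B : ℕ) (j : Fin B) (y : ℝ) (z : Fin B → ℝ) (k : Fin B) : ℝ :=
  z k + 2 * y * basisVec B j k

/-- The MMSE of the channel at signal amplitude `y` when section `j` is sent. -/
def channelMMSE (B : ℕ) (j : Fin B) (y : ℝ) : ℝ :=
  ∫ z, ∑ i, (softmax (gibbsEnergy B j y z) i - basisVec B j i) ^ 2 ∂stdGauss B

/-- The posterior entropy of the channel at signal amplitude `y` when section `j` is sent. -/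
def channelEntropy (B : ℕ) (j : Fin B) (y : ℝ) : ℝ :=
  ∫ z, (Real.log (∑ k, rexp (gibbsEnergy B j y z k)) - gibbsEnergy B j y z j) ∂stdGauss B

section Channel

variable {B : ℕ} (j : Fin B)

theorem abs_basisVec_le_one (k : Fin B) : |basisVec B j k| ≤ 1 := by
  unfold basisVec; split_ifs <;> simp

theorem hasDerivAt_gibbsEnergy (y : ℝ) (z : Fin B → ℝ) (k : Fin B) :
    HasDerivAt (fun s => gibbsEnergy B j s z k) (gibbsEnergyDeriv B j y z k) y := by
  convert! ((hasDerivAt_id y).mul_const (z k)).add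
    (((hasDerivAt_id y).pow 2).mul_const (basisVec B j k)) using 1
  simp [gibbsEnergyDeriv]

theorem measurable_gibbsEnergy (y : ℝ) (k : Fin B) :
    Measurable fun z => gibbsEnergy B j y z k := by
  unfold gibbsEnergy; fun_prop

theorem measurable_gibbsEnergyDeriv (y : ℝ) (k : Fin B) :
    Measurable fun z => gibbsEnergyDeriv B j y z k := by
  unfold gibbsEnergyDeriv; fun_prop

theorem measurable_softmax_gibbsEnergy (y : ℝ) (k : Fin B) :
    Measurable fun z => softmax (gibbsEnergy B j y z) k := by
  have := measurable_gibbsEnergy j y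
  unfold softmax; fun_prop

theorem abs_gibbsEnergyDeriv_le (y : ℝ) (z : Fin B → ℝ) (k : Fin B) :
    |gibbsEnergyDeriv B j y z k| ≤ (∑ l, |z l|) + 2 * |y| := by
  have h1 : |z k| ≤ ∑ l, |z l| :=
    Finset.single_le_sum (f := fun l => |z l|) (fun l _ => abs_nonneg _) (mem_univ k)
  refine (abs_add_le _ _).trans (add_le_add h1 ?_)
  rw [abs_mul, abs_mul, abs_two]
  exact mul_le_of_le_one_right (by positivity) (abs_basisVec_le_one j k)

theorem abs_gibbsEnergy_le (y : ℝ) (z : Fin B → ℝ) (k : Fin B) :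
    |gibbsEnergy B j y z k| ≤ |y| * (∑ l, |z l|) + y ^ 2 := by
  have h1 : |z k| ≤ ∑ l, |z l| :=
    Finset.single_le_sum (f := fun l => |z l|) (fun l _ => abs_nonneg _) (mem_univ k)
  refine (abs_add_le _ _).trans (add_le_add ?_ ?_)
  · rw [abs_mul]
    exact mul_le_mul_of_nonneg_left h1 (abs_nonneg _)
  · rw [abs_mul, abs_of_nonneg (sq_nonneg y)]
    exact mul_le_of_le_one_right (by positivity) (abs_basisVec_le_one j k)

theorem integrable_sum_abs_stdGauss : Integrable (fun z : Fin B → ℝ => ∑ l, |z l|) (stdGauss B) :=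
  integrable_finsetSum _ fun l _ => (integrable_eval_stdGauss B l).abs

theorem integrable_softmax_gibbsEnergy (y : ℝ) (k : Fin B) :
    Integrable (fun z => softmax (gibbsEnergy B j y z) k) (stdGauss B) :=
  have : Nonempty (Fin B) := ⟨j⟩
  Integrable.of_bound (measurable_softmax_gibbsEnergy j y k).aestronglyMeasurable 1
    (ae_of_all _ fun _ => abs_softmax_le_one _ _)

theorem integrable_softmax_gibbsEnergy_sq (y : ℝ) (k : Fin B) :
    Integrable (fun z => softmax (gibbsEnergy B j y z) k ^ 2) (stdGauss B) := by
  have : Nonempty (Fin B) := ⟨j⟩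
  refine Integrable.of_bound
    ((measurable_softmax_gibbsEnergy j y k).pow_const 2).aestronglyMeasurable 1
    (ae_of_all _ fun z => ?_)
  rw [Real.norm_eq_abs, abs_pow]
  exact pow_le_one₀ (abs_nonneg _) (abs_softmax_le_one _ _)

theorem integrable_eval_mul_softmax (y : ℝ) (k : Fin B) :
    Integrable (fun z => z k * softmax (gibbsEnergy B j y z) k) (stdGauss B) :=
  have : Nonempty (Fin B) := ⟨j⟩
  (integrable_eval_stdGauss B k).mul_bdd
    (measurable_softmax_gibbsEnergy j y k).aestronglyMeasurable
    (ae_of_all _ fun _ => abs_softmax_le_one _ _)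

theorem integral_eval_mul_softmax (y : ℝ) (k : Fin B) :
    ∫ z, z k * softmax (gibbsEnergy B j y z) k ∂stdGauss B =
      y * (∫ z, softmax (gibbsEnergy B j y z) k ∂stdGauss B -
        ∫ z, softmax (gibbsEnergy B j y z) k ^ 2 ∂stdGauss B) := by
  have : Nonempty (Fin B) := ⟨j⟩
  rw [← integral_sub (integrable_softmax_gibbsEnergy j y k)
    (integrable_softmax_gibbsEnergy_sq j y k), ← integral_const_mul]
  have hm := measurable_softmax_gibbsEnergy j y k
  refine integral_eval_mul_stdGauss k hm (by fun_prop) (fun z => ?_)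
    (fun z => abs_softmax_le_one _ k) (C' := |y|) (fun z => ?_)
  · have hu : ∀ l, HasDerivAt (fun t => gibbsEnergy B j y (Function.update z k t) l)
        (if l = k then y else 0) (z k) := by
      intro l
      unfold gibbsEnergy
      by_cases h : l = k
      · subst h
        simpa using ((hasDerivAt_id (z l)).const_mul y).add_const (y ^ 2 * basisVec B j l)
      · simpa [h] using hasDerivAt_const (z k) _
    convert! hasDerivAt_softmax hu k using 1
    simp [Function.update_eq_self]
    ring
  · have h0 := softmax_nonneg (gibbsEnergy B j y z) k
    have h1 := softmax_le_one (gibbsEnergy B j y z) k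
    rw [abs_mul]
    refine mul_le_of_le_one_right (abs_nonneg _) (abs_le.2 ⟨by nlinarith, by nlinarith⟩)

theorem sum_softmax_sub_basisVec_sq (u : Fin B → ℝ) :
    ∑ i, (softmax u i - basisVec B j i) ^ 2 =
      (∑ i, softmax u i ^ 2) - 2 * softmax u j + 1 := by
  have h : ∀ i, (softmax u i - basisVec B j i) ^ 2 =
      softmax u i ^ 2 - (if i = j then 2 * softmax u i - 1 else 0) := by
    intro i
    unfold basisVec
    split_ifs <;> ring
  simp only [h, Finset.sum_sub_distrib, Finset.sum_ite_eq', mem_univ, if_true]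
  ring

theorem integrable_sum_softmax_sub_basisVec_sq (y : ℝ) :
    Integrable (fun z => ∑ i, (softmax (gibbsEnergy B j y z) i - basisVec B j i) ^ 2)
      (stdGauss B) := by
  simp only [sum_softmax_sub_basisVec_sq]
  exact ((integrable_finsetSum _ fun i _ => integrable_softmax_gibbsEnergy_sq j y i).sub
    ((integrable_softmax_gibbsEnergy j y j).const_mul 2)).add (integrable_const 1)

theorem channelMMSE_eq (y : ℝ) :
    channelMMSE B j y = (∑ i, ∫ z, softmax (gibbsEnergy B j y z) i ^ 2 ∂stdGauss B) -
      2 * ∫ z, softmax (gibbsEnergy B j y z) j ∂stdGauss B + 1 := by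
  have h1 := integrable_finsetSum univ fun i _ => integrable_softmax_gibbsEnergy_sq j y i
  have h2 := (integrable_softmax_gibbsEnergy j y j).const_mul 2
  have h12 : Integrable (fun z => ∑ i, softmax (gibbsEnergy B j y z) i ^ 2 -
      2 * softmax (gibbsEnergy B j y z) j) (stdGauss B) := h1.sub h2
  unfold channelMMSE
  simp only [sum_softmax_sub_basisVec_sq]
  rw [integral_add h12 (integrable_const 1), integral_sub h1 h2,
    integral_finsetSum _ fun i _ => integrable_softmax_gibbsEnergy_sq j y i, integral_const_mul]
  simp

theorem integral_sum_softmax_mul_gibbsEnergyDeriv (y : ℝ) :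
    ∫ z, (∑ k, softmax (gibbsEnergy B j y z) k * gibbsEnergyDeriv B j y z k -
      gibbsEnergyDeriv B j y z j) ∂stdGauss B = -y * channelMMSE B j y := by
  have : Nonempty (Fin B) := ⟨j⟩
  have e : ∀ z, ∑ k, softmax (gibbsEnergy B j y z) k * gibbsEnergyDeriv B j y z k -
      gibbsEnergyDeriv B j y z j = (∑ k, z k * softmax (gibbsEnergy B j y z) k) +
        2 * y * softmax (gibbsEnergy B j y z) j - (z j + 2 * y) := by
    intro z
    simp only [gibbsEnergyDeriv, basisVec, mul_add, Finset.sum_add_distrib]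
    simp [mul_comm]
  have h1 := integrable_finsetSum univ fun k _ => integrable_eval_mul_softmax j y k
  have h2 := (integrable_softmax_gibbsEnergy j y j).const_mul (2 * y)
  have h3 := integrable_eval_stdGauss B j
  have hs : ∑ k, ∫ z, softmax (gibbsEnergy B j y z) k ∂stdGauss B = 1 := by
    rw [← integral_finsetSum _ fun k _ => integrable_softmax_gibbsEnergy j y k]
    simp [sum_softmax]
  simp only [e]
  rw [integral_sub (h1.fun_add h2) (h3.fun_add (integrable_const _)), integral_add h1 h2,
    integral_add h3 (integrable_const _), integral_eval_stdGauss, integral_const_mul,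
    integral_finsetSum _ fun k _ => integrable_eval_mul_softmax j y k, channelMMSE_eq]
  simp only [integral_eval_mul_softmax, ← Finset.mul_sum, Finset.sum_sub_distrib, hs]
  simp
  ring

/-- The I-MMSE relation: the posterior entropy has derivative `-y * mmse` in the amplitude. -/
theorem hasDerivAt_channelEntropy (y : ℝ) :
    HasDerivAt (channelEntropy B j) (-y * channelMMSE B j y) y := by
  have : Nonempty (Fin B) := ⟨j⟩
  rw [← integral_sum_softmax_mul_gibbsEnergyDeriv]
  have hE := measurable_gibbsEnergy j
  have hE' := measurable_gibbsEnergyDeriv j y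
  have hp := measurable_softmax_gibbsEnergy j y
  have hS := integrable_sum_abs_stdGauss (B := B)
  refine (hasDerivAt_integral_of_dominated_loc_of_deriv_le
    (F' := fun y z => ∑ k, softmax (gibbsEnergy B j y z) k * gibbsEnergyDeriv B j y z k -
      gibbsEnergyDeriv B j y z j)
    (bound := fun z => 2 * ((∑ l, |z l|) + 2 * (|y| + 1)))
    (Metric.ball_mem_nhds y one_pos) (Eventually.of_forall fun s => ?_) ?_ ?_
    (ae_of_all _ fun z s hs => ?_) ((hS.add (integrable_const _)).const_mul 2)
    (ae_of_all _ fun z s _ => ?_)).2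
  · have := hE s
    exact Measurable.aestronglyMeasurable (by fun_prop)
  · have hb : Integrable (fun z : Fin B → ℝ => |y| * (∑ l, |z l|) + y ^ 2) (stdGauss B) :=
      (hS.const_mul _).add (integrable_const _)
    have := hE y
    refine Integrable.mono' (((integrable_const (Real.log (Fintype.card (Fin B)))).add hb).add hb)
      (Measurable.aestronglyMeasurable (by fun_prop)) (ae_of_all _ fun z => ?_)
    exact (abs_sub _ _).trans (add_le_add (abs_log_sum_exp_le _ (abs_gibbsEnergy_le j y z))
      (abs_gibbsEnergy_le j y z j))
  · exact Measurable.aestronglyMeasurable (by fun_prop)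
  · have hs' : |s| ≤ |y| + 1 := by
      have h := Metric.mem_ball.1 hs
      rw [Real.dist_eq] at h
      linarith [abs_sub_abs_le_abs_sub s y]
    have h1 := abs_sum_softmax_mul_le (gibbsEnergy B j s z) _ (abs_gibbsEnergyDeriv_le j s z)
    have h2 := abs_gibbsEnergyDeriv_le j s z j
    refine (abs_sub _ _).trans ?_
    linarith
  · exact (hasDerivAt_log_sum_exp (hasDerivAt_gibbsEnergy j s z)).sub
      (hasDerivAt_gibbsEnergy j s z j)

theorem differentiable_channelMMSE : Differentiable ℝ (channelMMSE B j) := by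
  intro y
  have : Nonempty (Fin B) := ⟨j⟩
  have hE' := measurable_gibbsEnergyDeriv j y
  have hp := measurable_softmax_gibbsEnergy j
  have hS := integrable_sum_abs_stdGauss (B := B)
  refine (hasDerivAt_integral_of_dominated_loc_of_deriv_le
    (F' := fun y z => ∑ i, 2 * (softmax (gibbsEnergy B j y z) i - basisVec B j i) *
      (softmax (gibbsEnergy B j y z) i * (gibbsEnergyDeriv B j y z i -
        ∑ k, softmax (gibbsEnergy B j y z) k * gibbsEnergyDeriv B j y z k)))
    (bound := fun z => ∑ _i : Fin B, 4 * (2 * ((∑ l, |z l|) + 2 * (|y| + 1))))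
    (Metric.ball_mem_nhds y one_pos) (Eventually.of_forall fun s => ?_)
    (integrable_sum_softmax_sub_basisVec_sq j y) ?_
    (ae_of_all _ fun z s hs => ?_) (integrable_finsetSum _ fun _ _ =>
      ((hS.add (integrable_const _)).const_mul 2).const_mul 4)
    (ae_of_all _ fun z s _ => ?_)).2.differentiableAt
  · have := hp s
    exact Measurable.aestronglyMeasurable (by fun_prop)
  · have := hp y
    exact Measurable.aestronglyMeasurable (by fun_prop)
  · have hs' : |s| ≤ |y| + 1 := by
      have h := Metric.mem_ball.1 hs
      rw [Real.dist_eq] at h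
      linarith [abs_sub_abs_le_abs_sub s y]
    have h1 := abs_sum_softmax_mul_le (gibbsEnergy B j s z) _ (abs_gibbsEnergyDeriv_le j s z)
    refine (Finset.abs_sum_le_sum_abs _ _).trans (Finset.sum_le_sum fun i _ => ?_)
    have h2 := abs_gibbsEnergyDeriv_le j s z i
    have h3 := abs_softmax_le_one (gibbsEnergy B j s z) i
    rw [abs_mul, abs_mul, abs_mul, abs_two]
    refine mul_le_mul ?_ ?_ (by positivity) (by norm_num)
    · linarith [abs_sub (softmax (gibbsEnergy B j s z) i) (basisVec B j i),
        abs_basisVec_le_one j i]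
    · refine (mul_le_of_le_one_left (abs_nonneg _) h3).trans ((abs_sub _ _).trans ?_)
      linarith
  · refine HasDerivAt.fun_sum fun i _ => ?_
    convert! ((hasDerivAt_softmax (hasDerivAt_gibbsEnergy j s z) i).sub_const
      (basisVec B j i)).pow 2 using 1
    simp

theorem channelMMSE_eq_channelMMSE (j j' : Fin B) (y : ℝ) :
    channelMMSE B j y = channelMMSE B j' y := by
  unfold channelMMSE
  rw [← integral_comp_perm_stdGauss (Equiv.swap j j')]
  refine integral_congr_ae (ae_of_all _ fun z => ?_)
  have hb : ∀ k, basisVec B j (Equiv.swap j j' k) = basisVec B j' k := by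
    intro k
    have : Equiv.swap j j' k = j ↔ k = j' := by
      rw [Equiv.swap_apply_eq_iff, Equiv.swap_apply_left]
    simp [basisVec, this]
  have hg : ∀ k, gibbsEnergy B j y (z ∘ Equiv.swap j j') (Equiv.swap j j' k) =
      gibbsEnergy B j' y z k := by
    intro k
    simp [gibbsEnergy, hb]
  have hs : ∀ k, softmax (gibbsEnergy B j y (z ∘ Equiv.swap j j')) (Equiv.swap j j' k) =
      softmax (gibbsEnergy B j' y z) k := by
    intro k
    rw [softmax, softmax, hg, ← Equiv.sum_comp (Equiv.swap j j')]
    simp only [hg]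
  dsimp only
  rw [← Equiv.sum_comp (Equiv.swap j j')]
  simp only [hs, hb]

end Channel

theorem mmseB_inv_sqrt {B : ℕ} (j : Fin B) (q : ℝ) (hq : 0 < q) :
    mmseB B (√q)⁻¹ = channelMMSE B j (√(logb 2 B) * √q) := by
  have hB : 1 ≤ B := j.pos
  have hL : 0 ≤ logb 2 B := logb_nonneg one_lt_two (by exact_mod_cast hB)
  have hd : ∀ j' z i, denoiser B (√q)⁻¹ (basisVec B j') z i =
      softmax (gibbsEnergy B j' (√(logb 2 B) * √q) z) i := by
    intro j' z i
    rw [softmax_eq_inv, denoiser]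
    refine congrArg (fun x => (1 + x)⁻¹) (Finset.sum_congr rfl fun k _ => congrArg rexp ?_)
    rw [gibbsEnergy, gibbsEnergy, mul_pow, sq_sqrt hL, sq_sqrt hq.le, inv_pow, sq_sqrt hq.le,
      div_inv_eq_mul, div_inv_eq_mul]
    ring
  have h : ∀ j' : Fin B, ∫ z, (∑ i, (denoiser B (√q)⁻¹ (basisVec B j') z i -
      basisVec B j' i) ^ 2) ∂stdGauss B = channelMMSE B j (√(logb 2 B) * √q) := by
    intro j'
    rw [channelMMSE_eq_channelMMSE j j']
    simp only [hd, channelMMSE]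
  rw [mmseB, Finset.sum_congr rfl fun j' _ => h j']
  have hB' : (B : ℝ) ≠ 0 := by exact_mod_cast (by omega : B ≠ 0)
  simp [hB']

theorem exists_Su_inv_sqrt {B : ℕ} (hB : 0 < B) :
    ∃ j : Fin B, ∀ q : ℝ, 0 < q →
      Su B (√q)⁻¹ = channelEntropy B j (√(logb 2 B) * √q) / Real.log B := by
  let _ : NeZero B := ⟨hB.ne'⟩
  refine ⟨0, fun q hq => ?_⟩
  have hL : 0 ≤ logb 2 B := logb_nonneg one_lt_two (by exact_mod_cast hB)
  have : Nonempty (Fin B) := ⟨0⟩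
  have hlog : ∀ u : Fin B → ℝ, Real.log (∑ k, rexp (u k)) - u 0 =
      Real.log (1 + ∑ k ∈ univ.erase (0 : Fin B), rexp (u k - u 0)) := by
    intro u
    have h := softmax_eq_inv u 0
    rw [← inv_inv (1 + _), ← h, softmax, inv_div,
      Real.log_div (sum_exp_pos u).ne' (exp_pos _).ne', Real.log_exp]
  rw [Su, dif_pos hB, channelEntropy, ← integral_div]
  refine integral_congr_ae (ae_of_all _ fun z => ?_)
  dsimp only
  rw [hlog, logb]
  refine congrArg (fun x => Real.log (1 + x) / Real.log B)
    (Finset.sum_congr rfl fun k hk => congrArg rexp ?_)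
  have hk0 : k ≠ 0 := (Finset.mem_erase.1 hk).1
  rw [gibbsEnergy, gibbsEnergy, mul_pow, sq_sqrt hL, sq_sqrt hq.le, inv_pow, sq_sqrt hq.le,
      div_inv_eq_mul, div_inv_eq_mul]
  simp only [basisVec, if_neg hk0, if_true]
  ring

theorem hasDerivAt_Su_inv_sqrt {B : ℕ} (hB : 2 ≤ B) {q : ℝ} (hq : 0 < q) :
    HasDerivAt (fun q => Su B (√q)⁻¹) (-(1 / (2 * Real.log 2)) * mmseB B (√q)⁻¹) q := by
  obtain ⟨j, hj⟩ := exists_Su_inv_sqrt (by omega : 0 < B)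
  have hB' : (1 : ℝ) < B := by exact_mod_cast (by omega : 1 < B)
  have hlog : Real.log B ≠ 0 := (Real.log_pos hB').ne'
  have hlog2 : Real.log 2 ≠ 0 := (Real.log_pos one_lt_two).ne'
  have hL : 0 ≤ logb 2 B := logb_nonneg one_lt_two hB'.le
  have h := (((hasDerivAt_channelEntropy j (√(logb 2 B) * √q)).comp q
    ((hasDerivAt_sqrt hq.ne').const_mul √(logb 2 B))).div_const (Real.log B)).congr_of_eventuallyEq
      (f₁ := fun q => Su B (√q)⁻¹)
      ((eventually_gt_nhds hq).mono fun x hx => by simpa using hj x hx)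
  convert! h using 1
  have hs : √q ≠ 0 := (sqrt_pos.2 hq).ne'
  rw [mmseB_inv_sqrt j q hq]
  have e : -(√(logb 2 B) * √q) * channelMMSE B j (√(logb 2 B) * √q) *
      (√(logb 2 B) * (1 / (2 * √q))) =
      -(√(logb 2 B) ^ 2 * channelMMSE B j (√(logb 2 B) * √q) / 2) := by
    field_simp
  rw [e, sq_sqrt hL, logb]
  field_simp

theorem differentiableAt_mmseB_inv_sqrt {B : ℕ} (hB : 0 < B) {q : ℝ} (hq : 0 < q) :
    DifferentiableAt ℝ (fun q => mmseB B (√q)⁻¹) q := by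
  have h : DifferentiableAt ℝ (fun q => channelMMSE B ⟨0, hB⟩ (√(logb 2 B) * √q)) q :=
    (differentiable_channelMMSE _ _).comp q
      ((hasDerivAt_sqrt hq.ne').differentiableAt.const_mul _)
  exact h.congr_of_eventuallyEq
    ((eventually_gt_nhds hq).mono fun x hx => mmseB_inv_sqrt _ x hx)

theorem hasDerivAt_Uu {R σ2 x : ℝ} (hx : 0 < σ2 + x) :
    HasDerivAt (Uu R σ2) (1 / (2 * R * Real.log 2) * (x / (σ2 + x) ^ 2)) x := by
  have h1 : HasDerivAt (fun y => σ2 + y) 1 x := (hasDerivAt_id x).const_add σ2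
  have h2 := ((hasDerivAt_id x).div h1 hx.ne').neg.exp
  have h3 := ((h1.mul h2).log (mul_pos hx (exp_pos _)).ne').div_const (Real.log 2)
  convert! h3.const_mul (1 / (2 * R)) using 1
  simp
  field_simp
  ring

/-- The inverse effective noise variance `Σ_c(E)⁻²`. -/
def blockSnr (R σ2 : ℝ) (Γ : ℕ) (J : Fin Γ → Fin Γ → ℝ) (c : Fin Γ) (P : Fin Γ → ℝ) : ℝ :=
  (Γ : ℝ)⁻¹ * ∑ r, J r c / (R * (σ2 + P r))

/-- The partial derivative of the coupled potential in the coordinate `r`. -/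
def gradFc (B : ℕ) (R σ2 : ℝ) (Γ : ℕ) (J : Fin Γ → Fin Γ → ℝ) (r : Fin Γ) (P : Fin Γ → ℝ) : ℝ :=
  1 / (2 * R * Real.log 2) * ((P r - Tc B R σ2 Γ J P r) / (σ2 + P r) ^ 2)

section Coupled

variable {B : ℕ} {R σ2 : ℝ} {Γ : ℕ} {J : Fin Γ → Fin Γ → ℝ} {P : Fin Γ → ℝ}

theorem blockSnr_pos (hR : 0 < R) (hJ : ∀ r c, 0 ≤ J r c) (hJd : ∀ c, 0 < J c c)
    (hP : ∀ r, 0 < σ2 + P r) (c : Fin Γ) : 0 < blockSnr R σ2 Γ J c P := by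
  have hΓ : (0 : ℝ) < Γ := by exact_mod_cast c.pos
  refine mul_pos (inv_pos.2 hΓ) (Finset.sum_pos' (fun r _ => ?_) ⟨c, mem_univ c, ?_⟩)
  · exact div_nonneg (hJ r c) (mul_pos hR (hP r)).le
  · exact div_pos (hJd c) (mul_pos hR (hP c))

theorem hasFDerivAt_blockSnr (hR : 0 < R) (hP : ∀ r, 0 < σ2 + P r) (c : Fin Γ) :
    HasFDerivAt (blockSnr R σ2 Γ J c)
      (∑ r, (-((Γ : ℝ)⁻¹ * (J r c / (R * (σ2 + P r) ^ 2)))) •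
        (ContinuousLinearMap.proj r : (Fin Γ → ℝ) →L[ℝ] ℝ)) P := by
  have h : ∀ r, HasFDerivAt (fun P : Fin Γ → ℝ => J r c / (R * (σ2 + P r)))
      ((-(J r c / (R * (σ2 + P r) ^ 2))) •
        (ContinuousLinearMap.proj r : (Fin Γ → ℝ) →L[ℝ] ℝ)) P := by
    intro r
    have h1 : HasDerivAt (fun x => J r c / (R * (σ2 + x))) (-(J r c / (R * (σ2 + P r) ^ 2)))
        (P r) := by
      have hne := (hP r).ne'
      convert! (hasDerivAt_const (P r) (J r c)).div
        (((hasDerivAt_id (P r)).const_add σ2).const_mul R) (mul_pos hR (hP r)).ne' using 1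
      simp
      field_simp
    exact HasDerivAt.comp_hasFDerivAt (f := fun P : Fin Γ → ℝ => P r) P h1 (hasFDerivAt_apply r P)
  convert! (HasFDerivAt.fun_sum fun r (_ : r ∈ univ) => h r).const_mul (Γ : ℝ)⁻¹ using 1
  rw [Finset.smul_sum]
  exact Finset.sum_congr rfl fun r _ => by rw [smul_smul, mul_neg]

theorem hasFDerivAt_Fc (hB : 2 ≤ B) (hR : 0 < R) (hJ : ∀ r c, 0 ≤ J r c) (hJd : ∀ c, 0 < J c c)
    (hP : ∀ r, 0 < σ2 + P r) :
    HasFDerivAt (Fc B R σ2 Γ J) (∑ r, gradFc B R σ2 Γ J r P •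
      (ContinuousLinearMap.proj r : (Fin Γ → ℝ) →L[ℝ] ℝ)) P := by
  have h1 : ∀ r, HasFDerivAt (fun P : Fin Γ → ℝ => Uu R σ2 (P r))
      ((1 / (2 * R * Real.log 2) * (P r / (σ2 + P r) ^ 2)) •
        (ContinuousLinearMap.proj r : (Fin Γ → ℝ) →L[ℝ] ℝ)) P := fun r =>
    HasDerivAt.comp_hasFDerivAt (f := fun P : Fin Γ → ℝ => P r) P
      (hasDerivAt_Uu (hP r)) (hasFDerivAt_apply r P)
  have h2 := fun c => HasDerivAt.comp_hasFDerivAt (f := blockSnr R σ2 Γ J c) P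
    (hasDerivAt_Su_inv_sqrt hB (blockSnr_pos hR hJ hJd hP c))
    (hasFDerivAt_blockSnr (J := J) hR hP c)
  convert! (HasFDerivAt.fun_sum fun r (_ : r ∈ univ) => h1 r).sub
    (HasFDerivAt.fun_sum fun c (_ : c ∈ univ) => h2 c) using 1
  ext v
  simp only [ContinuousLinearMap.sub_apply, ContinuousLinearMap.sum_apply,
    ContinuousLinearMap.smul_apply, ContinuousLinearMap.proj_apply, smul_eq_mul, Finset.mul_sum]
  rw [Finset.sum_comm, ← Finset.sum_sub_distrib]
  refine Finset.sum_congr rfl fun r _ => ?_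
  have e : Tc B R σ2 Γ J P r =
      ∑ c, (Γ : ℝ)⁻¹ * (J r c * mmseB B (√(blockSnr R σ2 Γ J c P))⁻¹) := by
    rw [Tc, Finset.mul_sum]
    rfl
  rw [gradFc, e, sub_div, mul_sub, sub_mul, mul_assoc, Finset.sum_div, Finset.mul_sum,
    Finset.sum_mul, mul_assoc]
  congr 1
  refine Finset.sum_congr rfl fun c _ => ?_
  have hne := (hP r).ne'
  have hlog2 : Real.log 2 ≠ 0 := (Real.log_pos one_lt_two).ne'
  field_simp

theorem differentiableAt_gradFc (hB : 2 ≤ B) (hR : 0 < R) (hJ : ∀ r c, 0 ≤ J r c)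
    (hJd : ∀ c, 0 < J c c) (hP : ∀ r, 0 < σ2 + P r) (r : Fin Γ) :
    DifferentiableAt ℝ (gradFc B R σ2 Γ J r) P := by
  have h : ∀ c, DifferentiableAt ℝ (fun P => mmseB B (sigC R σ2 Γ J P c)) P := fun c =>
    (differentiableAt_mmseB_inv_sqrt (by omega : 0 < B) (blockSnr_pos hR hJ hJd hP c)).comp P
      (hasFDerivAt_blockSnr (J := J) hR hP c).differentiableAt
  have hT : DifferentiableAt ℝ (fun P => Tc B R σ2 Γ J P r) P := by
    unfold Tc; fun_prop
  have hr : DifferentiableAt ℝ (fun P : Fin Γ → ℝ => P r) P := by fun_prop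
  have hn : DifferentiableAt ℝ (fun P : Fin Γ → ℝ => (σ2 + P r) ^ 2) P := by fun_prop
  unfold gradFc
  simp only [div_eq_mul_inv (_ - _)]
  exact ((hr.fun_sub hT).fun_mul (hn.fun_inv (pow_pos (hP r) 2).ne')).const_mul _

end Coupled

/-- Second-order Taylor formula with Lagrange remainder for a function vanishing to first order
at `a` in the direction `b - a`. -/
theorem exists_taylor_pderiv {n : ℕ} {F : (Fin n → ℝ) → ℝ} {G : Fin n → (Fin n → ℝ) → ℝ}
    {Ω : Set (Fin n → ℝ)} (hΩ : IsOpen Ω) (hconv : Convex ℝ Ω)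
    (hF : ∀ P ∈ Ω, HasFDerivAt F (∑ r, G r P •
      (ContinuousLinearMap.proj r : (Fin n → ℝ) →L[ℝ] ℝ)) P)
    (hG : ∀ r, ∀ P ∈ Ω, DifferentiableAt ℝ (G r) P) {a b : Fin n → ℝ} (ha : a ∈ Ω) (hb : b ∈ Ω)
    (h0 : ∑ r, G r a * (b r - a r) = 0) :
    ∃ t ∈ Set.Icc (0 : ℝ) 1, F b - F a = (1 / 2) * ∑ r, ∑ r', (a r - b r) * (a r' - b r') *
      pderiv n (pderiv n F r') r (fun i => (1 - t) * a i + t * b i) := by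
  have hupd : ∀ (f : (Fin n → ℝ) → ℝ) (L : (Fin n → ℝ) →L[ℝ] ℝ) (P : Fin n → ℝ) (r : Fin n),
      HasFDerivAt f L P → pderiv n f r P = L (Pi.single r 1) := by
    intro f L P r hf
    refine HasDerivAt.deriv ?_
    refine HasFDerivAt.comp_hasDerivAt (P r) ?_ (hasDerivAt_update P r (P r))
    rwa [Function.update_eq_self]
  have hp1 : ∀ r, ∀ P ∈ Ω, pderiv n F r P = G r P := by
    intro r P hP
    rw [hupd F _ P r (hF P hP)]
    simp [Pi.single_apply]
  have hp2 : ∀ r r', ∀ P ∈ Ω, pderiv n (pderiv n F r') r P =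
      fderiv ℝ (G r') P (Pi.single r 1) := by
    intro r r' P hP
    exact hupd _ _ P r ((hG r' P hP).hasFDerivAt.congr_of_eventuallyEq
      (Filter.mem_of_superset (hΩ.mem_nhds hP) fun Q hQ => hp1 r' Q hQ))
  set ℓ : ℝ → Fin n → ℝ := fun t i => (1 - t) * a i + t * b i with hℓ
  have hℓΩ : ∀ t ∈ Set.Icc (0 : ℝ) 1, ℓ t ∈ Ω := fun t ht =>
    hconv ha hb (sub_nonneg.2 ht.2) ht.1 (by ring)
  have hℓ' : ∀ t, HasDerivAt ℓ (b - a) t := by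
    intro t
    refine hasDerivAt_pi.2 fun i => ?_
    convert! (((hasDerivAt_id t).const_sub 1).mul_const (a i)).add
      ((hasDerivAt_id t).mul_const (b i)) using 1
    simp
    ring
  have hφ : ∀ t ∈ Set.Icc (0 : ℝ) 1,
      HasDerivAt (fun t => F (ℓ t)) (∑ r, G r (ℓ t) * (b r - a r)) t := by
    intro t ht
    convert! (hF _ (hℓΩ t ht)).comp_hasDerivAt t (hℓ' t) using 1
    simp
  have hφ' : ∀ t ∈ Set.Icc (0 : ℝ) 1, HasDerivAt (fun t => ∑ r, G r (ℓ t) * (b r - a r))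
      (∑ r, fderiv ℝ (G r) (ℓ t) (b - a) * (b r - a r)) t := fun t ht =>
    HasDerivAt.fun_sum fun r _ =>
      ((hG r _ (hℓΩ t ht)).hasFDerivAt.comp_hasDerivAt t (hℓ' t)).mul_const _
  obtain ⟨c, hc, hcφ⟩ := exists_ratio_hasDerivAt_eq_ratio_slope (fun t => F (ℓ t))
    (fun t => ∑ r, G r (ℓ t) * (b r - a r)) zero_lt_one
    (fun t ht => (hφ t ht).continuousAt.continuousWithinAt)
    (fun t ht => hφ t (Set.Ioo_subset_Icc_self ht)) (fun t => t ^ 2) (fun t => 2 * t)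
    (by fun_prop) (fun t _ => by simpa using hasDerivAt_pow 2 t)
  have hsub : Set.Icc 0 c ⊆ Set.Icc (0 : ℝ) 1 := Set.Icc_subset_Icc_right hc.2.le
  obtain ⟨t, ht, htφ⟩ := exists_hasDerivAt_eq_slope (fun t => ∑ r, G r (ℓ t) * (b r - a r)) _ hc.1
    (fun t ht => (hφ' t (hsub ht)).continuousAt.continuousWithinAt)
    (fun t ht => hφ' t (hsub (Set.Ioo_subset_Icc_self ht)))
  have ht1 := hsub (Set.Ioo_subset_Icc_self ht)
  refine ⟨t, ht1, ?_⟩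
  have hℓ0 : ℓ 0 = a := by ext i; simp [hℓ]
  have hℓ1 : ℓ 1 = b := by ext i; simp [hℓ]
  have hexp : ∑ r, ∑ r', (a r - b r) * (a r' - b r') * pderiv n (pderiv n F r') r (ℓ t) =
      ∑ r, fderiv ℝ (G r) (ℓ t) (b - a) * (b r - a r) := by
    rw [Finset.sum_comm]
    refine Finset.sum_congr rfl fun r' _ => ?_
    rw [pi_eq_sum_univ' (b - a), map_sum, Finset.sum_mul]
    refine Finset.sum_congr rfl fun r _ => ?_
    rw [hp2 r r' _ (hℓΩ t ht1), map_smul]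
    simp
    ring
  change F b - F a = 1 / 2 * ∑ r, ∑ r', (a r - b r) * (a r' - b r') *
    pderiv n (pderiv n F r') r (ℓ t)
  rw [hexp, htφ]
  simp only [hℓ0, hℓ1, h0] at hcφ ⊢
  have hc0 := hc.1.ne'
  field_simp
  linarith

/-- exact Taylor remainder formula for the change of the coupled
potential under the shift of a saturated profile. -/
theorem coupled_potential_change_taylor
    (B : ℕ) (hB : 2 ≤ B) (R σ2 : ℝ) (hR : 0 < R) (hσ2 : 0 < σ2)
    (Γ w : ℕ) (hw : 0 < w) (hΓ : 8 * w < Γ)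
    (g : ℝ → ℝ) (g0 gs : ℝ) (hg0 : 0 < g0) (hgs : 0 ≤ gs)
    (hsupp : ∀ x : ℝ, 1 < |x| → g x = 0)
    (hlow : ∀ x : ℝ, |x| ≤ 1 → g0 ≤ g x)
    (hlip : ∀ x ∈ Set.Icc (-1:ℝ) 1, ∀ y ∈ Set.Icc (-1:ℝ) 1, |g x - g y| ≤ gs * |x - y|)
    (hgnorm : (2*(w:ℝ)+1)⁻¹ * ∑ k ∈ Finset.Icc (-(w:ℤ)) (w:ℤ), g ((k:ℝ)/(w:ℝ)) = 1)
    (γv : Fin Γ → ℝ) (hγ : ∀ r, 0 < γv r)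
    (J : Fin Γ → Fin Γ → ℝ)
    (hJ : ∀ r c : Fin Γ, J r c = γv r * (Γ:ℝ) * g (((r.1:ℝ) - (c.1:ℝ))/(w:ℝ)) / (2*(w:ℝ)+1))
    (hrow : ∀ r : Fin Γ, (Γ:ℝ)⁻¹ * ∑ c, J r c = 1)
    (E : Fin Γ → ℝ) (rstar rmax : Fin Γ) (Emax : ℝ)
    (hbox : ∀ r, E r ∈ Set.Icc (0:ℝ) 1)
    (hmono : ∀ r r' : Fin Γ, r ≤ r' → E r ≤ E r')
    (hrsm : rstar ≤ rmax)
    (hplat0 : ∀ r, r ≤ rstar → E r = mseFloor B R σ2)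
    (hplatmax : ∀ r, rmax ≤ r → E r = Emax)
    (hfixmid : ∀ r : Fin Γ, rstar < r → r ≤ rmax → E r = Tc B R σ2 Γ J E r) :
    ∃ th ∈ Set.Icc (0:ℝ) 1,
      Fc B R σ2 Γ J (shiftProf Γ (mseFloor B R σ2) E) - Fc B R σ2 Γ J E =
        (1/2) * ∑ r : Fin Γ, ∑ r' : Fin Γ,
          (E r - shiftProf Γ (mseFloor B R σ2) E r) *
          (E r' - shiftProf Γ (mseFloor B R σ2) E r') *
          pderiv Γ (pderiv Γ (Fc B R σ2 Γ J) r') r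
            (fun i => (1 - th) * E i + th * shiftProf Γ (mseFloor B R σ2) E i) := by
  have hgn : ∀ x, 0 ≤ g x := fun x =>
    (le_or_gt |x| 1).elim (fun h => hg0.le.trans (hlow x h)) fun h => (hsupp x h).ge
  have hJn : ∀ r c, 0 ≤ J r c := by
    intro r c
    have := hgn (((r.1:ℝ) - (c.1:ℝ))/(w:ℝ))
    have := (hγ r).le
    rw [hJ]
    positivity
  have hJd : ∀ c, 0 < J c c := by
    intro c
    have h1 : 0 < g (((c.1:ℝ) - (c.1:ℝ))/(w:ℝ)) := hg0.trans_le (hlow _ (by simp))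
    have h2 := hγ c
    have h3 : (0 : ℝ) < Γ := by exact_mod_cast c.pos
    rw [hJ]
    positivity
  have hE0 : 0 ≤ mseFloor B R σ2 := hplat0 rstar le_rfl ▸ (hbox rstar).1
  have hΩ : {P : Fin Γ → ℝ | ∀ r, 0 < σ2 + P r} = Set.univ.pi fun _ => Set.Ioi (-σ2) := by
    ext P
    simp [neg_lt_iff_pos_add']
  refine exists_taylor_pderiv (Ω := {P | ∀ r, 0 < σ2 + P r}) (G := gradFc B R σ2 Γ J)
    (hΩ ▸ isOpen_set_pi Set.finite_univ fun _ _ => isOpen_Ioi)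
    (hΩ ▸ convex_pi fun _ _ => convex_Ioi _)
    (fun P hP => hasFDerivAt_Fc hB hR hJn hJd hP)
    (fun r P hP => differentiableAt_gradFc hB hR hJn hJd hP r)
    (fun r => by linarith [(hbox r).1]) (fun r => ?_) (Finset.sum_eq_zero fun r _ => ?_)
  · unfold shiftProf
    split_ifs
    · linarith
    · linarith [(hbox ⟨r.1 - 1, lt_of_le_of_lt (Nat.sub_le _ _) r.isLt⟩).1]
  · rcases le_or_gt r rstar with h | h
    · have : shiftProf Γ (mseFloor B R σ2) E r = E r := by
        rw [hplat0 r h, shiftProf]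
        split_ifs
        · rfl
        · exact hplat0 _ (le_trans (Fin.le_def.2 (Nat.sub_le _ _)) h)
      rw [this, sub_self, mul_zero]
    · rcases le_or_gt r rmax with h' | h'
      · rw [gradFc, ← hfixmid r h h', sub_self, zero_div, mul_zero, zero_mul]
      · have h1 := Fin.lt_def.1 h'
        have : shiftProf Γ (mseFloor B R σ2) E r = E r := by
          rw [hplatmax r h'.le, shiftProf, if_neg (by omega)]
          exact hplatmax _ (Fin.le_def.2 (by simp only; omega))
        rw [this, sub_self, mul_zero]
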